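/- There is a universal constant C > 0 such that the following holds for all n ≥ 2, d ≥ 1, and all density matrices ρ, σ on ℂ^d. Let ϱ = ρ^{⊗n} ⊗ σ^{⊗n} (indexed by pairs (x,y), x, y : Fin n → Fin d, with entry ∏_s ρ[x s, x' s]·∏_t σ[y t, y' t]). Let O_{ρρ} be the average over transpositions of Fin n of the operator permuting the corresponding two ρ-factors, O_{σσ} the analogous average for the σ-factors, and O_{ρσ} = (1/n²)·Σ_{s,t ∈ Fin n} X_{s,t}, where X_{s,t} swaps the s-th ρ-factor with the t-th σ-factor. Set O = O_{ρρ} + O_{σσ} − 2·O_{ρσ}. Then tr(ϱ·O) = tr((ρ−σ)²), and tr(ϱ·O²) − (tr(ϱ·O))² ≤ C·(1/n² + tr((ρ−σ)²)/n). -/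

import Mathlib

open Matrix
open scoped ComplexOrder

/-- The state `ρ^{⊗n} ⊗ σ^{⊗n}` as a matrix indexed by pairs
`(x, y)` with `x, y : Fin n → Fin d`. -/
noncomputable def pairState (n d : ℕ) (ρ σ : Matrix (Fin d) (Fin d) ℂ) :
    Matrix ((Fin n → Fin d) × (Fin n → Fin d)) ((Fin n → Fin d) × (Fin n → Fin d)) ℂ :=
  Matrix.of fun p q => (∏ s, ρ (p.1 s) (q.1 s)) * ∏ t, σ (p.2 t) (q.2 t)

/-- The operator `X_{s,t}` swapping the `s`-th ρ-factor with the `t`-th σ-factor. -/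
noncomputable def swapOp (n d : ℕ) (s t : Fin n) :
    Matrix ((Fin n → Fin d) × (Fin n → Fin d)) ((Fin n → Fin d) × (Fin n → Fin d)) ℂ :=
  Matrix.of fun p q =>
    if (∀ i, i ≠ s → q.1 i = p.1 i) ∧ (∀ j, j ≠ t → q.2 j = p.2 j) ∧
        q.1 s = p.2 t ∧ q.2 t = p.1 s
    then 1 else 0

/-- The observable `O_{(ρσ)} = (1/n²) Σ_{s,t} X_{s,t}`. -/
noncomputable def Oρσ (n d : ℕ) :
    Matrix ((Fin n → Fin d) × (Fin n → Fin d)) ((Fin n → Fin d) × (Fin n → Fin d)) ℂ :=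
  (1 / ((n : ℂ) * (n : ℂ))) • ∑ s : Fin n, ∑ t : Fin n, swapOp n d s t

/-- The operator permuting the ρ-factors according to `π` and fixing the σ-factors. -/
noncomputable def permOpLeft (n d : ℕ) (π : Equiv.Perm (Fin n)) :
    Matrix ((Fin n → Fin d) × (Fin n → Fin d)) ((Fin n → Fin d) × (Fin n → Fin d)) ℂ :=
  Matrix.of fun p q => if q.1 = p.1 ∘ ⇑π ∧ q.2 = p.2 then 1 else 0

/-- The operator permuting the σ-factors according to `π` and fixing the ρ-factors. -/
noncomputable def permOpRight (n d : ℕ) (π : Equiv.Perm (Fin n)) :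
    Matrix ((Fin n → Fin d) × (Fin n → Fin d)) ((Fin n → Fin d) × (Fin n → Fin d)) ℂ :=
  Matrix.of fun p q => if q.1 = p.1 ∧ q.2 = p.2 ∘ ⇑π then 1 else 0

/-- The set of transpositions in the symmetric group on `Fin n`. -/
noncomputable def transpositions (n : ℕ) : Finset (Equiv.Perm (Fin n)) :=
  @Finset.filter _ (fun τ : Equiv.Perm (Fin n) => τ.IsSwap) (Classical.decPred _)
    Finset.univ

/-- The observable `O_{(ρρ)}`: the average over transpositions of `Fin n` of the
operator permuting the corresponding two ρ-factors. -/
noncomputable def Oρρ (n d : ℕ) :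
    Matrix ((Fin n → Fin d) × (Fin n → Fin d)) ((Fin n → Fin d) × (Fin n → Fin d)) ℂ :=
  ((transpositions n).card : ℂ)⁻¹ • ∑ τ ∈ transpositions n, permOpLeft n d τ

/-- The observable `O_{(σσ)}`: the average over transpositions of `Fin n` of the
operator permuting the corresponding two σ-factors. -/
noncomputable def Oσσ (n d : ℕ) :
    Matrix ((Fin n → Fin d) × (Fin n → Fin d)) ((Fin n → Fin d) × (Fin n → Fin d)) ℂ :=
  ((transpositions n).card : ℂ)⁻¹ • ∑ τ ∈ transpositions n, permOpRight n d τ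

section LoopTrace

variable {S T R D : Type*} [Fintype S] [Fintype T] [Fintype R] [Fintype D]
  [DecidableEq S] [DecidableEq T] [DecidableEq R]

/-- The product operator `⨂ s, A s` as a matrix indexed by `S → D`. -/
def tensorFamily (A : S → Matrix D D ℂ) : Matrix (S → D) (S → D) ℂ :=
  Matrix.of fun p q => ∏ s, A s (p s) (q s)

/-- The operator permuting the tensor factors indexed by `S` according to `π`. -/
def factorPerm (D : Type*) [DecidableEq D] (π : Equiv.Perm S) : Matrix (S → D) (S → D) ℂ :=
  Matrix.of fun p q => if q = p ∘ π then 1 else 0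

/-- The contraction of the matrices `A s` along a self-map of the index type; for a permutation
this is the product over its cycles of the traces of the products along the cycles. -/
def loopTrace (A : S → Matrix D D ℂ) (f : S → S) : ℂ :=
  ∑ q : S → D, ∏ s, A s (q (f s)) (q s)

theorem factorPerm_mul [DecidableEq D] (π τ : Equiv.Perm S) :
    factorPerm D π * factorPerm D τ = factorPerm D (π * τ) := by
  ext p q
  simp only [factorPerm, Matrix.mul_apply, Matrix.of_apply, ite_mul, one_mul, zero_mul,
    Finset.sum_ite_eq', Finset.mem_univ, if_true, Equiv.Perm.coe_mul,
    Function.comp_assoc]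
  congr

theorem trace_tensorFamily_mul_factorPerm [DecidableEq D] (A : S → Matrix D D ℂ)
    (π : Equiv.Perm S) :
    (tensorFamily A * factorPerm D π).trace = loopTrace A π := by
  simp only [Matrix.trace, Matrix.diag, Matrix.mul_apply, tensorFamily, factorPerm,
    Matrix.of_apply, loopTrace]
  rw [Finset.sum_comm]
  simp

theorem loopTrace_equiv (e : T ≃ S) (A : S → Matrix D D ℂ) (f : S → S) (g : T → T)
    (h : ∀ t, f (e t) = e (g t)) : loopTrace A f = loopTrace (A ∘ e) g := by
  refine Fintype.sum_equiv (e.symm.arrowCongr (Equiv.refl D)) _ _ fun q => ?_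
  refine Fintype.prod_equiv e.symm _ _ fun s => ?_
  simp [← h]

theorem loopTrace_sum (A : T ⊕ R → Matrix D D ℂ) (f : T → T) (g : R → R) :
    loopTrace A (Sum.map f g) = loopTrace (A ∘ Sum.inl) f * loopTrace (A ∘ Sum.inr) g := by
  rw [loopTrace, loopTrace, loopTrace, Finset.sum_mul_sum, ← Fintype.sum_prod_type']
  refine Fintype.sum_equiv (Equiv.sumArrowEquivProdArrow T R D) _ _ fun q => ?_
  simp [Equiv.sumArrowEquivProdArrow]

theorem loopTrace_id (A : S → Matrix D D ℂ) (hA : ∀ s, (A s).trace = 1) :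
    loopTrace A id = 1 := by
  classical
  have h := Finset.prod_univ_sum (fun _ : S => (Finset.univ : Finset D)) fun s a => A s a a
  rw [Fintype.piFinset_univ] at h
  rw [loopTrace]
  simp only [id]
  rw [← h]
  exact Finset.prod_eq_one fun s _ => hA s

theorem loopTrace_of_injective (A : S → Matrix D D ℂ) (hA : ∀ s, (A s).trace = 1)
    (e : T → S) (he : Function.Injective e) (f : S → S) (g : T → T)
    (hfg : ∀ t, f (e t) = e (g t)) (hf : ∀ s, (∀ t, e t ≠ s) → f s = s) :
    loopTrace A f = loopTrace (A ∘ e) g := by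
  classical
  let E : T ⊕ ↥(Set.range e)ᶜ ≃ S :=
    ((Equiv.ofInjective e he).sumCongr (Equiv.refl _)).trans (Equiv.Set.sumCompl _)
  rw [loopTrace_equiv E A f (Sum.map g id), loopTrace_sum, loopTrace_id, mul_one]
  · rfl
  · exact fun s => hA _
  · rintro (t | ⟨s, hs⟩)
    · exact hfg t
    · exact hf s fun t ht => hs ⟨t, ht⟩

theorem loopTrace_fin_two (A : Fin 2 → Matrix D D ℂ) :
    loopTrace A ![1, 0] = (A 0 * A 1).trace := by
  rw [loopTrace, ← (finTwoArrowEquiv D).symm.sum_comp, Fintype.sum_prod_type, Finset.sum_comm]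
  simp [Matrix.trace, Matrix.mul_apply]

theorem loopTrace_fin_three (A : Fin 3 → Matrix D D ℂ) :
    loopTrace A ![2, 0, 1] = (A 0 * A 1 * A 2).trace := by
  rw [loopTrace, ← (Fin.consEquiv fun _ => D).sum_comp, Fintype.sum_prod_type]
  simp_rw [← (finTwoArrowEquiv D).symm.sum_comp, Fintype.sum_prod_type]
  simp only [Matrix.trace, Matrix.diag, Matrix.mul_apply, Finset.sum_mul, Fin.prod_univ_three]
  rw [Finset.sum_comm, Finset.sum_congr rfl fun _ _ => Finset.sum_comm, Finset.sum_comm]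
  simp

theorem loopTrace_swap {A : S → Matrix D D ℂ} (hA : ∀ s, (A s).trace = 1) {i j : S}
    (hij : i ≠ j) : loopTrace A (Equiv.swap i j) = (A i * A j).trace := by
  rw [loopTrace_of_injective A hA ![i, j] _ _ ![1, 0], loopTrace_fin_two]
  · rfl
  · simp [Fin.forall_fin_two]
  · intro s hs
    exact Equiv.swap_apply_of_ne_of_ne (hs 0).symm (hs 1).symm
  · intro a b
    fin_cases a <;> fin_cases b <;> simp [hij, hij.symm]

theorem loopTrace_swap_mul_swap_of_common {A : S → Matrix D D ℂ} (hA : ∀ s, (A s).trace = 1)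
    {i j l : S} (hij : i ≠ j) (hil : i ≠ l) (hjl : j ≠ l) :
    loopTrace A (Equiv.swap i j * Equiv.swap i l : Equiv.Perm S) = (A i * A j * A l).trace := by
  rw [loopTrace_of_injective A hA ![i, j, l] _ _ ![2, 0, 1], loopTrace_fin_three]
  · rfl
  · intro t
    fin_cases t <;> simp [Equiv.swap_apply_of_ne_of_ne, hij.symm, hil.symm, hjl, hjl.symm]
  · intro s hs
    have h0 := (hs 0).symm
    have h1 := (hs 1).symm
    have h2 := (hs 2).symm
    simp_all [Equiv.swap_apply_of_ne_of_ne]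
  · intro a b
    fin_cases a <;> fin_cases b <;> simp [hij, hij.symm, hil, hil.symm, hjl, hjl.symm]

theorem loopTrace_swap_mul_swap_of_disjoint {A : S → Matrix D D ℂ} (hA : ∀ s, (A s).trace = 1)
    {i j k l : S} (hij : i ≠ j) (hkl : k ≠ l) (hik : i ≠ k) (hil : i ≠ l) (hjk : j ≠ k)
    (hjl : j ≠ l) :
    loopTrace A (Equiv.swap i j * Equiv.swap k l : Equiv.Perm S) =
      (A i * A j).trace * (A k * A l).trace := by
  rw [loopTrace_of_injective A hA (Sum.elim ![i, j] ![k, l]) _ _ (Sum.map ![1, 0] ![1, 0]),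
    loopTrace_sum, loopTrace_fin_two, loopTrace_fin_two]
  · rfl
  · rintro (t | t) <;> fin_cases t <;>
      simp [Equiv.swap_apply_of_ne_of_ne, hik, hil, hik.symm, hil.symm, hjk, hjl, hjk.symm,
        hjl.symm]
  · intro s hs
    have h0 := (hs (Sum.inl 0)).symm
    have h1 := (hs (Sum.inl 1)).symm
    have h2 := (hs (Sum.inr 0)).symm
    have h3 := (hs (Sum.inr 1)).symm
    simp_all [Equiv.swap_apply_of_ne_of_ne]
  · rintro (a | a) (b | b) <;> fin_cases a <;> fin_cases b <;>
      simp [hij, hij.symm, hkl, hkl.symm, hik, hik.symm, hil, hil.symm, hjk, hjk.symm, hjl,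
        hjl.symm]

theorem loopTrace_swap_mul_swap {A : S → Matrix D D ℂ} (hA : ∀ s, (A s).trace = 1)
    {i j k l : S} (hij : i ≠ j) (hkl : k ≠ l) :
    loopTrace A (Equiv.swap i j * Equiv.swap k l : Equiv.Perm S) =
      (A i * A j).trace * (A k * A l).trace +
        ((if i = k then (A i * A j * A l).trace - (A i * A j).trace * (A i * A l).trace else 0) +
        (if i = l then (A i * A j * A k).trace - (A i * A j).trace * (A i * A k).trace else 0) +
        (if j = k then (A j * A i * A l).trace - (A j * A i).trace * (A j * A l).trace else 0) +
        (if j = l then (A j * A i * A k).trace - (A j * A i).trace * (A j * A k).trace else 0)) +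
        ((if i = k then if j = l then (1 + (A i * A j).trace ^ 2 - (A i * A j * A j).trace -
            (A j * A i * A i).trace) else 0 else 0) +
        (if i = l then if j = k then (1 + (A i * A j).trace ^ 2 - (A i * A j * A j).trace -
            (A j * A i * A i).trace) else 0 else 0)) := by
  have h1 : loopTrace A (1 : Equiv.Perm S) = 1 := loopTrace_id A hA
  by_cases hik : i = k
  · subst hik
    by_cases hjl : j = l
    · subst hjl
      rw [Equiv.swap_mul_self, h1, Matrix.trace_mul_comm (A j) (A i)]
      simp [hij, hij.symm]
      ring
    · rw [loopTrace_swap_mul_swap_of_common hA hij hkl hjl]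
      simp [hij.symm, hkl, hjl]
  by_cases hil : i = l
  · subst hil
    by_cases hjk : j = k
    · subst hjk
      rw [Equiv.swap_comm j i, Equiv.swap_mul_self, h1, Matrix.trace_mul_comm (A j) (A i)]
      simp [hij, hij.symm]
      ring
    · rw [Equiv.swap_comm k i, loopTrace_swap_mul_swap_of_common hA hij hik hjk,
        Matrix.trace_mul_comm (A k) (A i)]
      simp [hik, hjk, hij.symm]
  by_cases hjk : j = k
  · subst hjk
    rw [Equiv.swap_comm i j, loopTrace_swap_mul_swap_of_common hA hij.symm hkl hil,
      Matrix.trace_mul_comm (A i) (A j)]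
    simp [hil, hkl, hij]
  by_cases hjl : j = l
  · subst hjl
    rw [Equiv.swap_comm i j, Equiv.swap_comm k j,
      loopTrace_swap_mul_swap_of_common hA hij.symm hjk hik,
      Matrix.trace_mul_comm (A i) (A j), Matrix.trace_mul_comm (A k) (A j)]
    simp [hij, hik, hjk]
  rw [loopTrace_swap_mul_swap_of_disjoint hA hij hkl hik hil hjk hjl]
  simp [hik, hil, hjk, hjl]

/-- The weighted sum of the operators swapping two tensor factors. -/
def swapSum (D : Type*) [DecidableEq D] (v : S → S → ℂ) : Matrix (S → D) (S → D) ℂ :=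
  ∑ i, ∑ j, v i j • factorPerm D (Equiv.swap i j)

theorem trace_tensorFamily_mul_swapSum [DecidableEq D] {A : S → Matrix D D ℂ}
    (hA : ∀ s, (A s).trace = 1)
    {v : S → S → ℂ} (hv : ∀ i, v i i = 0) :
    (tensorFamily A * swapSum D v).trace = ∑ i, ∑ j, v i j * (A i * A j).trace := by
  simp only [swapSum, Finset.mul_sum, Matrix.trace_sum, Matrix.mul_smul, Matrix.trace_smul,
    trace_tensorFamily_mul_factorPerm, smul_eq_mul]
  refine Finset.sum_congr rfl fun i _ => Finset.sum_congr rfl fun j _ => ?_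
  obtain rfl | hij := eq_or_ne i j
  · simp [hv]
  · rw [loopTrace_swap hA hij]

theorem trace_tensorFamily_mul_swapSum_sq [DecidableEq D] {A : S → Matrix D D ℂ}
    (hA : ∀ s, (A s).trace = 1)
    {v : S → S → ℂ} (hv : ∀ i, v i i = 0) (hs : ∀ i j, v i j = v j i) :
    (tensorFamily A * swapSum D v ^ 2).trace = (tensorFamily A * swapSum D v).trace ^ 2 +
      4 * ∑ i, ((A i * (∑ j, v i j • A j) ^ 2).trace - (A i * ∑ j, v i j • A j).trace ^ 2) +
      2 * ∑ i, ∑ j, v i j ^ 2 * (1 + (A i * A j).trace ^ 2 - (A i * A j * A j).trace -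
            (A j * A i * A i).trace) := by
  have comm4 : ∀ F : S → S → S → S → ℂ, ∑ i, ∑ j, ∑ k, ∑ l, F i j k l =
      ∑ k, ∑ l, ∑ i, ∑ j, F i j k l := by
    intro F
    simpa only [Fintype.sum_prod_type] using
      Finset.sum_comm (s := (Finset.univ : Finset (S × S))) (t := (Finset.univ : Finset (S × S)))
        (f := fun p q => F p.1 p.2 q.1 q.2)
  have key : (tensorFamily A * swapSum D v ^ 2).trace = ∑ i, ∑ j, ∑ k, ∑ l, v i j * v k l *
      loopTrace A (Equiv.swap i j * Equiv.swap k l : Equiv.Perm S) := by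
    simp only [swapSum, pow_two, Finset.mul_sum, Finset.sum_mul, Matrix.trace_sum,
      Matrix.mul_smul, Matrix.smul_mul, Matrix.trace_smul, factorPerm_mul,
      trace_tensorFamily_mul_factorPerm, smul_eq_mul]
    rw [comm4]
    exact Finset.sum_congr rfl fun i _ => Finset.sum_congr rfl fun j _ =>
      Finset.sum_congr rfl fun k _ => Finset.sum_congr rfl fun l _ => by ring
  rw [key, trace_tensorFamily_mul_swapSum hA hv]
  have hterm : ∀ i j k l, v i j * v k l *
      loopTrace A (Equiv.swap i j * Equiv.swap k l : Equiv.Perm S) =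
      (v i j * (A i * A j).trace) * (v k l * (A k * A l).trace) +
        ((if i = k then v i j * v k l *
            ((A i * A j * A l).trace - (A i * A j).trace * (A i * A l).trace) else 0) +
        (if i = l then v i j * v k l *
            ((A i * A j * A k).trace - (A i * A j).trace * (A i * A k).trace) else 0) +
        (if j = k then v i j * v k l *
            ((A j * A i * A l).trace - (A j * A i).trace * (A j * A l).trace) else 0) +
        (if j = l then v i j * v k l *
            ((A j * A i * A k).trace - (A j * A i).trace * (A j * A k).trace) else 0)) +
        ((if i = k then if j = l then v i j * v k l *
            (1 + (A i * A j).trace ^ 2 - (A i * A j * A j).trace -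
            (A j * A i * A i).trace) else 0 else 0) +
        (if i = l then if j = k then v i j * v k l *
            (1 + (A i * A j).trace ^ 2 - (A i * A j * A j).trace -
            (A j * A i * A i).trace) else 0 else 0)) := by
    intro i j k l
    obtain rfl | hij := eq_or_ne i j
    · simp [hv]
    obtain rfl | hkl := eq_or_ne k l
    · simp [hv]
    rw [loopTrace_swap_mul_swap hA hij hkl]
    split_ifs <;> ring
  have hsq : ∀ i, ∑ j, ∑ l, v i j * v i l *
      ((A i * A j * A l).trace - (A i * A j).trace * (A i * A l).trace) =
      (A i * (∑ j, v i j • A j) ^ 2).trace - (A i * ∑ j, v i j • A j).trace ^ 2 := by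
    intro i
    simp only [pow_two, Finset.mul_sum, Finset.sum_mul, Matrix.trace_sum, Matrix.mul_smul,
      Matrix.smul_mul, Matrix.trace_smul, smul_eq_mul, ← Finset.sum_sub_distrib, mul_assoc]
    rw [Finset.sum_comm]
    exact Finset.sum_congr rfl fun i _ => Finset.sum_congr rfl fun j _ => by ring
  simp only [hterm, Finset.sum_add_distrib]
  have h1 : ∑ i, ∑ j, ∑ k, ∑ l, (v i j * (A i * A j).trace) * (v k l * (A k * A l).trace) =
      (∑ i, ∑ j, v i j * (A i * A j).trace) ^ 2 := by
    simp only [pow_two, Finset.mul_sum, Finset.sum_mul]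
    rw [comm4]
  have h2 : ∀ F : S → S → S → S → ℂ, ∑ i, ∑ j, ∑ k, ∑ l, (if i = k then F i j k l else 0) =
      ∑ i, ∑ j, ∑ l, F i j i l := by
    intro F
    refine Finset.sum_congr rfl fun i _ => Finset.sum_congr rfl fun j _ => ?_
    rw [Finset.sum_comm]
    simp
  have h3 : ∀ F : S → S → S → S → ℂ, ∑ i, ∑ j, ∑ k, ∑ l, (if i = l then F i j k l else 0) =
      ∑ i, ∑ j, ∑ k, F i j k i := by
    simp
  have h4 : ∀ F : S → S → S → S → ℂ, ∑ i, ∑ j, ∑ k, ∑ l, (if j = k then F i j k l else 0) =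
      ∑ j, ∑ i, ∑ l, F i j j l := by
    intro F
    rw [Finset.sum_comm]
    refine Finset.sum_congr rfl fun i _ => Finset.sum_congr rfl fun j _ => ?_
    rw [Finset.sum_comm]
    simp
  have h5 : ∀ F : S → S → S → S → ℂ, ∑ i, ∑ j, ∑ k, ∑ l, (if j = l then F i j k l else 0) =
      ∑ j, ∑ i, ∑ k, F i j k j := by
    intro F
    rw [Finset.sum_comm]
    simp
  rw [h1, h2, h3, h4, h5, h2, h3]
  simp only [Finset.sum_ite_eq, Finset.mem_univ, if_true, hs _ _, ← hsq]
  simp only [pow_two (v _ _)]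
  ring

end LoopTrace

section PosSemidef

theorem Matrix.IsHermitian.trace_mul_im {D : Type*} [Fintype D] {A B : Matrix D D ℂ}
    (hA : A.IsHermitian) (hB : B.IsHermitian) : (A * B).trace.im = 0 := by
  rw [← Complex.conj_eq_iff_im, starRingEnd_apply, ← Matrix.trace_conjTranspose,
    Matrix.conjTranspose_mul, hA.eq, hB.eq, Matrix.trace_mul_comm]

variable {S D : Type*} [Fintype S] [DecidableEq S] [Fintype D] [DecidableEq D]

open scoped MatrixOrder Matrix.Norms.L2Operator in
theorem Matrix.PosSemidef.exists_eq_conjTranspose_mul_self {A : Matrix D D ℂ}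
    (hA : A.PosSemidef) : ∃ X : Matrix D D ℂ, A = Xᴴ * X :=
  CStarAlgebra.nonneg_iff_eq_star_mul_self.mp hA.nonneg

open scoped Matrix.Norms.Frobenius in
theorem trace_conjTranspose_mul_self_eq_frobenius_norm_sq (M : Matrix D D ℂ) :
    (Mᴴ * M).trace = ((‖M‖ ^ 2 : ℝ) : ℂ) := by
  have h : ‖M‖ ^ 2 = ∑ i, ∑ j, ‖M i j‖ ^ 2 := by
    rw [Matrix.frobenius_norm_def, ← Real.sqrt_eq_rpow, Real.sq_sqrt (by positivity)]
    simp
  rw [h, Finset.sum_comm]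
  simp [Matrix.trace, Matrix.mul_apply, Complex.conj_mul']

open scoped Matrix.Norms.Frobenius in
theorem Matrix.PosSemidef.trace_mul_nonneg_and_le {A B : Matrix D D ℂ} (hA : A.PosSemidef)
    (hB : B.PosSemidef) : 0 ≤ (A * B).trace ∧ (A * B).trace ≤ A.trace * B.trace := by
  obtain ⟨X, rfl⟩ := hA.exists_eq_conjTranspose_mul_self
  obtain ⟨Y, rfl⟩ := hB.exists_eq_conjTranspose_mul_self
  have h : (Xᴴ * X * (Yᴴ * Y)).trace = ((X * Yᴴ)ᴴ * (X * Yᴴ)).trace := by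
    rw [← Matrix.mul_assoc, Matrix.trace_mul_comm]
    simp [Matrix.mul_assoc]
  rw [h]
  simp only [trace_conjTranspose_mul_self_eq_frobenius_norm_sq]
  norm_cast
  refine ⟨by positivity, ?_⟩
  rw [← mul_pow, ← Matrix.frobenius_norm_conjTranspose Y]
  gcongr
  exact Matrix.frobenius_norm_mul _ _

theorem Matrix.IsHermitian.posSemidef_sq {B : Matrix D D ℂ} (hB : B.IsHermitian) :
    (B ^ 2).PosSemidef := by
  have := Matrix.posSemidef_conjTranspose_mul_self B
  rwa [hB.eq, ← pow_two] at this

theorem variance_swapSum_le {A : S → Matrix D D ℂ} (hA : ∀ s, (A s).trace = 1)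
    (hpos : ∀ s, (A s).PosSemidef) {v : S → S → ℝ} (hv : ∀ i, v i i = 0)
    (hs : ∀ i j, v i j = v j i) :
    (tensorFamily A * swapSum D (fun i j => (v i j : ℂ)) ^ 2).trace.re -
        (tensorFamily A * swapSum D (fun i j => (v i j : ℂ))).trace.re ^ 2 ≤
      4 * ∑ i, ((∑ j, (v i j : ℂ) • A j) ^ 2).trace.re + 4 * ∑ i, ∑ j, v i j ^ 2 := by
  have him : (tensorFamily A * swapSum D (fun i j => (v i j : ℂ))).trace.im = 0 := by
    rw [trace_tensorFamily_mul_swapSum hA (by simp [hv])]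
    simp [Complex.im_sum, (hpos _).isHermitian.trace_mul_im (hpos _).isHermitian]
  have hB : ∀ i, (∑ j, (v i j : ℂ) • A j).IsHermitian := by
    intro i
    simp [Matrix.IsHermitian, Matrix.conjTranspose_sum, Matrix.conjTranspose_smul,
      (hpos _).isHermitian.eq]
  rw [trace_tensorFamily_mul_swapSum_sq hA (by simp [hv]) (by simp [← hs])]
  have h1 : ∀ i, ((A i * (∑ j, (v i j : ℂ) • A j) ^ 2).trace -
      (A i * ∑ j, (v i j : ℂ) • A j).trace ^ 2).re ≤ ((∑ j, (v i j : ℂ) • A j) ^ 2).trace.re := by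
    intro i
    have h := ((hpos i).trace_mul_nonneg_and_le (hB i).posSemidef_sq).2
    rw [hA, one_mul] at h
    have h' := (hpos i).isHermitian.trace_mul_im (hB i)
    rw [Complex.sub_re, pow_two (Matrix.trace _), Complex.mul_re, h']
    nlinarith [(Complex.le_def.1 h).1]
  have h2 : ∀ i j, ((v i j : ℂ) ^ 2 * (1 + (A i * A j).trace ^ 2 - (A i * A j * A j).trace -
            (A j * A i * A i).trace)).re ≤ v i j ^ 2 * 2 := by
    intro i j
    rw [← Complex.ofReal_pow, Complex.re_ofReal_mul]
    gcongr
    have ha := (hpos i).trace_mul_nonneg_and_le (hpos j)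
    have hb := ((hpos i).trace_mul_nonneg_and_le (hpos j).isHermitian.posSemidef_sq).1
    have hc := ((hpos j).trace_mul_nonneg_and_le (hpos i).isHermitian.posSemidef_sq).1
    rw [hA, hA, one_mul] at ha
    rw [pow_two, ← Matrix.mul_assoc] at hb hc
    have hr := (Complex.le_def.1 ha.1).1
    have hr' := (Complex.le_def.1 ha.2).1
    have hb' := (Complex.le_def.1 hb).1
    have hc' := (Complex.le_def.1 hc).1
    have hi := (hpos i).isHermitian.trace_mul_im (hpos j).isHermitian
    simp only [Complex.sub_re, Complex.add_re, Complex.one_re, Complex.zero_re, pow_two,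
      Complex.mul_re, hi] at *
    nlinarith
  have h1' := Finset.sum_le_sum fun i (_ : i ∈ Finset.univ) => h1 i
  have h2' := Finset.sum_le_sum fun i (_ : i ∈ Finset.univ) =>
    Finset.sum_le_sum fun j (_ : j ∈ Finset.univ) => h2 i j
  simp only [← Complex.re_sum, ← Finset.sum_mul] at h1' h2'
  have e4 : ∀ z : ℂ, (4 * z).re = 4 * z.re := fun z => by simp
  have e2 : ∀ z : ℂ, (2 * z).re = 2 * z.re := fun z => by simp
  rw [Complex.add_re, Complex.add_re, e4, e2, pow_two (Matrix.trace _), Complex.mul_re, him]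
  simp only [← Complex.re_sum]
  linarith

end PosSemidef

section Pair

/-- Half of the coefficient with which a pair of factors of `ρ^{⊗n} ⊗ σ^{⊗n}` is swapped in the
observable: each unordered pair is counted twice in `swapSum`. -/
noncomputable def pairWeight (n : ℕ) : Fin n ⊕ Fin n → Fin n ⊕ Fin n → ℝ
  | Sum.inl i, Sum.inl j => if i = j then 0 else 1 / (n * (n - 1))
  | Sum.inr i, Sum.inr j => if i = j then 0 else 1 / (n * (n - 1))
  | _, _ => -1 / n ^ 2

theorem sum_sum_ite_swap {M : Type*} [AddCommMonoid M] (n : ℕ) (F : Equiv.Perm (Fin n) → M) :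
    ∑ i, ∑ j, (if i = j then 0 else F (Equiv.swap i j)) = 2 • ∑ τ ∈ transpositions n, F τ := by
  classical
  have hmem : ∀ p ∈ (Finset.univ : Finset (Fin n × Fin n)).filter (fun p => p.1 ≠ p.2),
      Equiv.swap p.1 p.2 ∈ transpositions n := by
    intro p hp
    simp only [transpositions, Finset.mem_filter, Finset.mem_univ, true_and] at hp ⊢
    exact ⟨p.1, p.2, hp, rfl⟩
  have hfib : ∀ τ ∈ transpositions n, ∑ p ∈ ((Finset.univ : Finset (Fin n × Fin n)).filter
      (fun p => p.1 ≠ p.2)).filter (fun p => Equiv.swap p.1 p.2 = τ),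
      F (Equiv.swap p.1 p.2) = 2 • F τ := by
    intro τ hτ
    obtain ⟨a, b, hab, rfl⟩ : τ.IsSwap := by simpa [transpositions] using hτ
    have hset : ((Finset.univ : Finset (Fin n × Fin n)).filter (fun p => p.1 ≠ p.2)).filter
        (fun p => Equiv.swap p.1 p.2 = Equiv.swap a b) = {(a, b), (b, a)} := by
      ext ⟨c, e⟩
      simp only [Finset.mem_filter, Finset.mem_univ, true_and, Finset.mem_insert,
        Finset.mem_singleton, Prod.mk.injEq]
      constructor
      · rintro ⟨hce, h⟩
        have h1 := Equiv.congr_fun h c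
        have h2 := Equiv.congr_fun h e
        simp only [Equiv.swap_apply_left, Equiv.swap_apply_right, Equiv.swap_apply_def] at h1 h2
        grind
      · rintro (⟨rfl, rfl⟩ | ⟨rfl, rfl⟩)
        · exact ⟨hab, rfl⟩
        · exact ⟨hab.symm, Equiv.swap_comm _ _⟩
    rw [hset, Finset.sum_pair (by simp [hab]), Equiv.swap_comm b a, two_nsmul]
  rw [Finset.smul_sum, ← Finset.sum_congr rfl hfib, Finset.sum_fiberwise_of_maps_to hmem,
    Finset.sum_filter, Fintype.sum_prod_type]
  simp only [ne_eq, ite_not]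

theorem card_transpositions_mul_two (n : ℕ) :
    ((transpositions n).card : ℂ) * 2 = n * (n - 1) := by
  have h := sum_sum_ite_swap n fun _ => (1 : ℂ)
  simp only [Finset.sum_const, nsmul_eq_mul, mul_one] at h
  rw [mul_comm]
  push_cast at h
  rw [← h]
  have hrow : ∀ i : Fin n, ∑ j, (if i = j then (0 : ℂ) else 1) = n - 1 := by
    intro i
    have hsub : ∀ j, (if i = j then (0 : ℂ) else 1) = 1 - if i = j then 1 else 0 := by
      intro j
      split_ifs <;> simp
    simp [hsub, Finset.sum_sub_distrib]
  simp only [hrow, Finset.sum_const, Finset.card_univ, Fintype.card_fin, nsmul_eq_mul]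

theorem pairState_eq_reindex (n d : ℕ) (ρ σ : Matrix (Fin d) (Fin d) ℂ) :
    pairState n d ρ σ = Matrix.reindexAlgEquiv ℂ ℂ (Equiv.sumArrowEquivProdArrow _ _ _)
      (tensorFamily (Sum.elim (fun _ : Fin n => ρ) fun _ : Fin n => σ)) := by
  ext p q
  simp [pairState, tensorFamily, Equiv.sumArrowEquivProdArrow]

theorem permOpLeft_eq_reindex (n d : ℕ) (π : Equiv.Perm (Fin n)) :
    permOpLeft n d π = Matrix.reindexAlgEquiv ℂ ℂ (Equiv.sumArrowEquivProdArrow _ _ _)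
      (factorPerm (Fin d) (Equiv.Perm.sumCongr π 1)) := by
  ext p q
  simp only [permOpLeft, factorPerm, Equiv.sumArrowEquivProdArrow, Matrix.coe_reindexAlgEquiv,
    Matrix.reindex_apply, Matrix.submatrix_apply, Matrix.of_apply]
  congr 1
  simp [funext_iff]

theorem permOpRight_eq_reindex (n d : ℕ) (π : Equiv.Perm (Fin n)) :
    permOpRight n d π = Matrix.reindexAlgEquiv ℂ ℂ (Equiv.sumArrowEquivProdArrow _ _ _)
      (factorPerm (Fin d) (Equiv.Perm.sumCongr 1 π)) := by
  ext p q
  simp only [permOpRight, factorPerm, Equiv.sumArrowEquivProdArrow, Matrix.coe_reindexAlgEquiv,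
    Matrix.reindex_apply, Matrix.submatrix_apply, Matrix.of_apply]
  congr 1
  simp [funext_iff]

theorem swapOp_eq_reindex (n d : ℕ) (s t : Fin n) :
    swapOp n d s t = Matrix.reindexAlgEquiv ℂ ℂ (Equiv.sumArrowEquivProdArrow _ _ _)
      (factorPerm (Fin d) (Equiv.swap (Sum.inl s) (Sum.inr t))) := by
  ext p q
  simp only [swapOp, factorPerm, Equiv.sumArrowEquivProdArrow, Matrix.coe_reindexAlgEquiv,
    Matrix.reindex_apply, Matrix.submatrix_apply, Matrix.of_apply]
  congr 1
  simp only [funext_iff, Sum.forall, Function.comp_apply, Equiv.coe_fn_symm_mk, Sum.elim_inl,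
    Equiv.swap_apply_def, eq_iff_iff]
  constructor
  · rintro ⟨h1, h2, h3, h4⟩
    constructor
    · intro i
      by_cases h : i = s <;> simp_all
    · intro i
      by_cases h : i = t <;> simp_all
  · rintro ⟨h1, h2⟩
    refine ⟨fun i hi => ?_, fun j hj => ?_, ?_, ?_⟩
    · simpa [hi] using h1 i
    · simpa [hj] using h2 j
    · simpa using h1 s
    · simpa using h2 t

theorem observable_eq_reindex (n d : ℕ) (hn : 2 ≤ n) :
    Oρρ n d + Oσσ n d - (2 : ℂ) • Oρσ n d =
      Matrix.reindexAlgEquiv ℂ ℂ (Equiv.sumArrowEquivProdArrow _ _ _)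
        (swapSum (Fin d) fun i j => (pairWeight n i j : ℂ)) := by
  have hn0 : (n : ℂ) ≠ 0 := by
    norm_cast
    lia
  have hn1 : (n : ℂ) - 1 ≠ 0 := by
    rw [sub_ne_zero]
    norm_cast
    lia
  have hcard : ((transpositions n).card : ℂ)⁻¹ = 2 * (1 / (n * (n - 1))) := by
    have h := card_transpositions_mul_two n
    have h0 : ((transpositions n).card : ℂ) ≠ 0 := by
      intro h0
      rw [h0, zero_mul] at h
      exact mul_ne_zero hn0 hn1 h.symm
    field_simp
    rw [← h, mul_comm]
  have hite : ∀ (i j : Fin n) (c : ℂ) (M : Matrix ((Fin n → Fin d) × (Fin n → Fin d))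
      ((Fin n → Fin d) × (Fin n → Fin d)) ℂ),
      (if i = j then 0 else c) • M = c • if i = j then 0 else M := by
    intro i j c M
    split_ifs <;> simp
  simp only [swapSum, map_add, map_sum, map_smul, Fintype.sum_sum_type, pairWeight,
    Finset.sum_add_distrib,
    ← Equiv.Perm.sumCongr_swap_one, ← Equiv.Perm.sumCongr_one_swap,
    Equiv.swap_comm (Sum.inr _) (Sum.inl _), ← swapOp_eq_reindex, ← permOpLeft_eq_reindex,
    ← permOpRight_eq_reindex, apply_ite Complex.ofReal]
  push_cast
  simp only [hite, ← Finset.smul_sum]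
  rw [sum_sum_ite_swap n (permOpLeft n d), sum_sum_ite_swap n (permOpRight n d),
    Finset.sum_comm (f := fun i j => swapOp n d j i), Oρρ, Oσσ, Oρσ, hcard]
  module

theorem pairWeight_self (n : ℕ) (i : Fin n ⊕ Fin n) : pairWeight n i i = 0 := by
  cases i <;> simp [pairWeight]

theorem pairWeight_comm (n : ℕ) (i j : Fin n ⊕ Fin n) : pairWeight n i j = pairWeight n j i := by
  cases i <;> cases j <;> simp [pairWeight, eq_comm]

theorem sum_ite_eq_zero_const (n : ℕ) (i : Fin n) (c : ℝ) :
    ∑ j, (if i = j then 0 else c) = (n - 1) * c := by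
  have hsub : ∀ j, (if i = j then 0 else c) = c - if i = j then c else 0 := by
    intro j
    split_ifs <;> simp
  simp [hsub, Finset.sum_sub_distrib]
  ring

theorem sum_pairWeight_smul (n d : ℕ) (hn : 2 ≤ n) (ρ σ : Matrix (Fin d) (Fin d) ℂ)
    (i : Fin n ⊕ Fin n) :
    ∑ j, (pairWeight n i j : ℂ) • Sum.elim (fun _ : Fin n => ρ) (fun _ : Fin n => σ) j =
      (Sum.elim (fun _ => 1 / n) (fun _ => -1 / n) i : ℂ) • (ρ - σ) := by
  have hn0 : (n : ℝ) ≠ 0 := by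
    norm_cast
    lia
  have hn1 : (n : ℝ) - 1 ≠ 0 := by
    rw [sub_ne_zero]
    norm_cast
    lia
  have h1 : ((n : ℝ) - 1) * (1 / (n * (n - 1))) = 1 / n := by field_simp
  have h2 : (n : ℝ) * (-1 / n ^ 2) = -1 / n := by field_simp
  cases i <;>
  · simp only [Fintype.sum_sum_type, pairWeight, Sum.elim_inl, Sum.elim_inr, ← Finset.sum_smul,
      ← Complex.ofReal_sum]
    simp only [sum_ite_eq_zero_const, Finset.sum_const, Finset.card_univ, Fintype.card_fin,
      nsmul_eq_mul, h1, h2]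
    push_cast
    module

theorem sum_pairWeight_sq_le (n : ℕ) (hn : 2 ≤ n) :
    ∑ i, ∑ j, pairWeight n i j ^ 2 ≤ 6 / (n : ℝ) ^ 2 := by
  have hn2 : (2 : ℝ) ≤ n := by exact_mod_cast hn
  have h : ∑ i, ∑ j, pairWeight n i j ^ 2 = 2 / (n * (n - 1)) + 2 / (n : ℝ) ^ 2 := by
    have hn1 : (n : ℝ) - 1 ≠ 0 := by linarith
    simp only [Fintype.sum_sum_type, pairWeight, ite_pow, ne_eq, OfNat.ofNat_ne_zero,
      not_false_eq_true, zero_pow, sum_ite_eq_zero_const, Finset.sum_const, Finset.card_univ,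
      Fintype.card_fin, nsmul_eq_mul]
    field_simp
    ring
  have hle : 2 / ((n : ℝ) * (n - 1)) ≤ 4 / (n : ℝ) ^ 2 := by
    rw [div_le_div_iff₀ (by nlinarith) (by positivity)]
    nlinarith
  rw [h, show (6 : ℝ) / (n : ℝ) ^ 2 = 4 / (n : ℝ) ^ 2 + 2 / (n : ℝ) ^ 2 by ring]
  linarith

theorem trace_reindexAlgEquiv {m k : Type*} [Fintype m] [Fintype k] [DecidableEq m]
    [DecidableEq k] (e : m ≃ k) (M : Matrix m m ℂ) :
    (Matrix.reindexAlgEquiv ℂ ℂ e M).trace = M.trace :=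
  Fintype.sum_equiv e.symm _ _ fun _ => rfl

end Pair

theorem stmt12 :
    ∃ C : ℝ, 0 < C ∧
      ∀ (n d : ℕ), 2 ≤ n → 1 ≤ d →
      ∀ ρ σ : Matrix (Fin d) (Fin d) ℂ,
        ρ.PosSemidef → ρ.trace = 1 → σ.PosSemidef → σ.trace = 1 →
        (pairState n d ρ σ * (Oρρ n d + Oσσ n d - (2 : ℂ) • Oρσ n d)).trace =
            (((ρ - σ) ^ 2).trace) ∧
          ((pairState n d ρ σ * (Oρρ n d + Oσσ n d - (2 : ℂ) • Oρσ n d) ^ 2).trace).re -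
              (((pairState n d ρ σ * (Oρρ n d + Oσσ n d - (2 : ℂ) • Oρσ n d)).trace).re) ^ 2 ≤
            C * (1 / (n : ℝ) ^ 2 + ((((ρ - σ) ^ 2).trace).re) / (n : ℝ)) := by
  refine ⟨24, by norm_num, fun n d hn _ ρ σ hρ hρ1 hσ hσ1 => ?_⟩
  have hn0 : (n : ℝ) ≠ 0 := by
    norm_cast
    lia
  have hn0' : (n : ℂ) ≠ 0 := by exact_mod_cast hn0
  have htr : ∀ s, (Sum.elim (fun _ : Fin n => ρ) (fun _ : Fin n => σ) s).trace = 1 := by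
    rintro (s | s)
    exacts [hρ1, hσ1]
  have hpos : ∀ s, (Sum.elim (fun _ : Fin n => ρ) (fun _ : Fin n => σ) s).PosSemidef := by
    rintro (s | s)
    exacts [hρ, hσ]
  rw [pairState_eq_reindex, observable_eq_reindex n d hn, ← map_pow, ← map_mul, ← map_mul,
    trace_reindexAlgEquiv, trace_reindexAlgEquiv]
  constructor
  · rw [trace_tensorFamily_mul_swapSum htr (by simp [pairWeight_self])]
    have hrow : ∀ i, ∑ j, (pairWeight n i j : ℂ) * (Sum.elim (fun _ : Fin n => ρ) (fun _ => σ) i *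
        Sum.elim (fun _ : Fin n => ρ) (fun _ => σ) j).trace =
        (Sum.elim (fun _ : Fin n => ρ) (fun _ => σ) i *
          ((Sum.elim (fun _ => 1 / n) (fun _ => -1 / n) i : ℂ) • (ρ - σ))).trace := by
      intro i
      simp only [← sum_pairWeight_smul n d hn, Finset.mul_sum, Matrix.trace_sum, Matrix.mul_smul,
        Matrix.trace_smul, smul_eq_mul]
    simp only [hrow]
    simp only [Fintype.sum_sum_type, Sum.elim_inl, Sum.elim_inr, Finset.sum_const,
      Finset.card_univ, Fintype.card_fin, Matrix.mul_smul, Matrix.trace_smul,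
      nsmul_eq_mul, smul_eq_mul, pow_two, Matrix.sub_mul, Matrix.trace_sub]
    field_simp
    ring
  · refine (variance_swapSum_le htr hpos (pairWeight_self n) (pairWeight_comm n)).trans ?_
    have hsq : ∀ i, ((∑ j, (pairWeight n i j : ℂ) •
        Sum.elim (fun _ : Fin n => ρ) (fun _ : Fin n => σ) j) ^ 2).trace.re =
        ((ρ - σ) ^ 2).trace.re / n ^ 2 := by
      intro i
      have hc : (Sum.elim (fun _ => 1 / n) (fun _ => -1 / n) i : ℂ) ^ 2 =
          ((1 / n ^ 2 : ℝ) : ℂ) := by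
        cases i <;> simp [div_pow]
      rw [sum_pairWeight_smul n d hn, smul_pow, hc, Matrix.trace_smul, smul_eq_mul,
        Complex.re_ofReal_mul]
      ring
    have hδ : 0 ≤ ((ρ - σ) ^ 2).trace.re :=
      (Complex.le_def.1 (hρ.isHermitian.sub hσ.isHermitian).posSemidef_sq.trace_nonneg).1
    simp only [hsq, Finset.sum_const, Finset.card_univ, Fintype.card_sum, Fintype.card_fin,
      nsmul_eq_mul]
    have hw := sum_pairWeight_sq_le n hn
    have h8 : 4 * (((n + n : ℕ) : ℝ) * (((ρ - σ) ^ 2).trace.re / n ^ 2)) =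
        8 * (((ρ - σ) ^ 2).trace.re / n) := by
      push_cast
      field_simp
      ring
    have hδn : 0 ≤ ((ρ - σ) ^ 2).trace.re / n := by positivity
    rw [h8, mul_add, show (24 : ℝ) * (1 / (n : ℝ) ^ 2) = 4 * (6 / (n : ℝ) ^ 2) by ring]
    linarith
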